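/- Let P be an augmented program and M ⊆ σ_P a set of atoms. Then AugFree(P) ∪ ¬M̃ ∪ ¬¬M ⊩_I M if and only if P ∪ ¬M̃ ∪ ¬¬M ⊩_I M. -/

import Mathlib

namespace ASP

/-- Propositional formulas over atoms `α`, built with ∧, ∨, ← and ⊥.
`impl A B` denotes the formula `B ← A` (i.e. `A → B`). -/
inductive PropForm (α : Type) : Type
  | var : α → PropForm α
  | fals : PropForm α
  | conj : PropForm α → PropForm α → PropForm α
  | disj : PropForm α → PropForm α → PropForm α
  | impl : PropForm α → PropForm α → PropForm α
  deriving DecidableEq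

namespace PropForm

variable {α : Type}

/-- `¬F` abbreviates `⊥ ← F`. -/
def neg (A : PropForm α) : PropForm α := impl A fals

/-- `⊤` abbreviates `⊥ ← ⊥`. -/
def top : PropForm α := impl fals fals

/-- The set of atoms occurring in a formula. -/
def atoms : PropForm α → Set α
  | var a => {a}
  | fals => ∅
  | conj A B => atoms A ∪ atoms B
  | disj A B => atoms A ∪ atoms B
  | impl A B => atoms A ∪ atoms B

end PropForm

open PropForm

/-- Hilbert-style derivability for intuitionistic propositional logic,
with an extra set `Ax` of additional axioms. -/
inductive Deriv {α : Type} (Ax : Set (PropForm α)) : PropForm α → Prop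
  | ax {A} : A ∈ Ax → Deriv Ax A
  | k (A B) : Deriv Ax (impl A (impl B A))
  | s (A B C) : Deriv Ax (impl (impl A (impl B C)) (impl (impl A B) (impl A C)))
  | conjIntro (A B) : Deriv Ax (impl A (impl B (conj A B)))
  | conjElimL (A B) : Deriv Ax (impl (conj A B) A)
  | conjElimR (A B) : Deriv Ax (impl (conj A B) B)
  | disjIntroL (A B) : Deriv Ax (impl A (disj A B))
  | disjIntroR (A B) : Deriv Ax (impl B (disj A B))
  | disjElim (A B C) : Deriv Ax (impl (impl A C) (impl (impl B C) (impl (disj A B) C)))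
  | falsElim (A) : Deriv Ax (impl fals A)
  | mp {A B} : Deriv Ax (impl A B) → Deriv Ax A → Deriv Ax B

/-- `F` is a theorem of intuitionistic propositional logic. -/
def IThm {α : Type} (F : PropForm α) : Prop := Deriv ∅ F

/-- `F` is a theorem of classical propositional logic
(intuitionistic logic plus double-negation elimination). -/
def CThm {α : Type} (F : PropForm α) : Prop :=
  Deriv {F | ∃ A, F = impl (neg (neg A)) A} F

/-- Conjunction of a finite list of formulas (empty conjunction is ⊤). -/
def bigConj {α : Type} : List (PropForm α) → PropForm α
  | [] => top
  | [A] => A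
  | A :: L => conj A (bigConj L)

/-- Disjunction of a finite list of formulas (empty disjunction is ⊥). -/
def bigDisj {α : Type} : List (PropForm α) → PropForm α
  | [] => fals
  | [A] => A
  | A :: L => disj A (bigDisj L)

/-- `T ⊢_X F`: the formula `F ← (F₁ ∧ ... ∧ Fₙ)` is a theorem of the logic
whose theorems are `Thm`, for some `F₁, ..., Fₙ ∈ T`. -/
def ProvesFrom {α : Type} (Thm : PropForm α → Prop) (T : Set (PropForm α))
    (F : PropForm α) : Prop :=
  ∃ L : List (PropForm α), (∀ G ∈ L, G ∈ T) ∧ Thm (impl (bigConj L) F)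

/-- `T ⊢_I F`. -/
def IProves {α : Type} (T : Set (PropForm α)) (F : PropForm α) : Prop :=
  ProvesFrom IThm T F

/-- `T ⊢_C F`. -/
def CProves {α : Type} (T : Set (PropForm α)) (F : PropForm α) : Prop :=
  ProvesFrom CThm T F

/-- `T` is consistent in intuitionistic logic. -/
def IConsistent {α : Type} (T : Set (PropForm α)) : Prop := ¬ IProves T fals

/-- `T ⊩_I M`: `T` is consistent and proves (intuitionistically) every atom of `M`. -/
def IProvesAll {α : Type} (T : Set (PropForm α)) (M : Set α) : Prop :=
  IConsistent T ∧ ∀ a ∈ M, IProves T (var a)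

/-- `T ≡_I U`: the two theories prove each other's formulas intuitionistically. -/
def IEquivTh {α : Type} (T U : Set (PropForm α)) : Prop :=
  (∀ F ∈ U, IProves T F) ∧ (∀ F ∈ T, IProves U F)

/-- The signature (set of occurring atoms) of a theory. -/
def sigTh {α : Type} (T : Set (PropForm α)) : Set α := ⋃ F ∈ T, F.atoms

/-- `T` is (literal) complete: for every atom `a` of its signature,
`T ⊢_I a` or `T ⊢_I ¬a`. -/
def IComplete {α : Type} (T : Set (PropForm α)) : Prop :=
  ∀ a ∈ sigTh T, IProves T (var a) ∨ IProves T (neg (var a))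

/-- `{¬a : a ∈ S}`. -/
def negSet {α : Type} (S : Set α) : Set (PropForm α) := (fun a => neg (var a)) '' S

/-- `{¬¬a : a ∈ S}`. -/
def negnegSet {α : Type} (S : Set α) : Set (PropForm α) :=
  (fun a => neg (neg (var a))) '' S

/-- Classical two-valued satisfaction, identifying an interpretation with the
set of atoms it makes true. -/
def sat2 {α : Type} (X : Set α) : PropForm α → Prop
  | .var a => a ∈ X
  | .fals => False
  | .conj A B => sat2 X A ∧ sat2 X B
  | .disj A B => sat2 X A ∨ sat2 X B
  | .impl A B => sat2 X A → sat2 X B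

/-- `X` is a classical model of the theory `T`. -/
def isModel2 {α : Type} (X : Set α) (T : Set (PropForm α)) : Prop := ∀ F ∈ T, sat2 X F

/-- `M` is a minimal (under ⊆) classical model of `T`. -/
def isMinModel {α : Type} (T : Set (PropForm α)) (M : Set α) : Prop :=
  isModel2 M T ∧ ∀ N ⊆ M, isModel2 N T → N = M

/-- Evaluation in the 3-valued Gödel logic G3. -/
def g3 {α : Type} (I : α → Fin 3) : PropForm α → Fin 3
  | .var a => I a
  | .fals => 0
  | .conj A B => min (g3 I A) (g3 I B)
  | .disj A B => max (g3 I A) (g3 I B)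
  | .impl A B => if g3 I A ≤ g3 I B then 2 else g3 I B

/-- Nested formulas: built from atoms, ⊤ and ⊥ using ∧, ∨ and ¬. -/
inductive NF (α : Type) : Type
  | var : α → NF α
  | top : NF α
  | bot : NF α
  | conj : NF α → NF α → NF α
  | disj : NF α → NF α → NF α
  | neg : NF α → NF α
  deriving DecidableEq

namespace NF

variable {α : Type}

/-- Reading a nested formula as a propositional formula
(`⊤ = ⊥ ← ⊥` and `¬F = ⊥ ← F`). -/
def toProp : NF α → PropForm α
  | var a => .var a
  | top => PropForm.top
  | bot => .fals
  | conj A B => .conj (toProp A) (toProp B)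
  | disj A B => .disj (toProp A) (toProp B)
  | neg A => PropForm.neg (toProp A)

/-- Atoms occurring in a nested formula. -/
def atoms : NF α → Set α
  | var a => {a}
  | top => ∅
  | bot => ∅
  | conj A B => atoms A ∪ atoms B
  | disj A B => atoms A ∪ atoms B
  | neg A => atoms A

/-- Satisfaction of a (basic, negation-free) nested formula by a set of atoms. -/
def satB (X : Set α) : NF α → Prop
  | var a => a ∈ X
  | top => True
  | bot => False
  | conj A B => satB X A ∧ satB X B
  | disj A B => satB X A ∨ satB X B
  | neg A => ¬ satB X A

open scoped Classical in
/-- The reduct `F^X`: each maximal subformula `¬G` is replaced by ⊥ if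
`X ⊨ G^X` and by ⊤ otherwise. -/
noncomputable def reduct (X : Set α) : NF α → NF α
  | var a => var a
  | top => top
  | bot => bot
  | conj A B => conj (reduct X A) (reduct X B)
  | disj A B => disj (reduct X A) (reduct X B)
  | neg A => if satB X (reduct X A) then bot else top

end NF

/-- An augmented clause `H ← B` is a pair `(H, B)` of nested formulas. -/
abbrev AugClause (α : Type) := NF α × NF α

/-- The propositional formula `H ← B` of an augmented clause. -/
def clauseToProp {α : Type} (c : AugClause α) : PropForm α :=
  .impl c.2.toProp c.1.toProp

/-- The theory of an augmented program. -/
def progTh {α : Type} (P : List (AugClause α)) : Set (PropForm α) :=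
  {F | ∃ c ∈ P, clauseToProp c = F}

/-- The signature of an augmented program. -/
def progSig {α : Type} (P : List (AugClause α)) : Set α :=
  {a | ∃ c ∈ P, a ∈ c.1.atoms ∪ c.2.atoms}

/-- `X` is closed under the (basic) program `P`: for each clause `H ← B`,
`X ⊨ H` whenever `X ⊨ B`. -/
def closedUnder {α : Type} (X : Set α) (P : List (AugClause α)) : Prop :=
  ∀ c ∈ P, NF.satB X c.2 → NF.satB X c.1

/-- The reduct `P^X` of an augmented program. -/
noncomputable def progReduct {α : Type} (X : Set α) (P : List (AugClause α)) :
    List (AugClause α) :=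
  P.map fun c => (c.1.reduct X, c.2.reduct X)

/-- `M` is an answer set of `P`: `M` is minimal (under ⊆) among the sets of
atoms closed under the reduct `P^M`. -/
def isAnswerSet {α : Type} (P : List (AugClause α)) (M : Set α) : Prop :=
  closedUnder M (progReduct M P) ∧ ∀ N ⊆ M, closedUnder N (progReduct M P) → N = M

/-- `M` is a min-answer set of `P`: both an answer set and a minimal model. -/
def isMinAnswerSet {α : Type} (P : List (AugClause α)) (M : Set α) : Prop :=
  isAnswerSet P M ∧ isMinModel (progTh P) M

/-- A G3 interpretation models an augmented program. -/
def g3ModelsProg {α : Type} (I : α → Fin 3) (P : List (AugClause α)) : Prop :=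
  ∀ c ∈ P, g3 I (clauseToProp c) = 2

/-- A free clause: a list of head literals and a list of body literals,
a literal being an atom `(a, true)` or a negated atom `(a, false)`.
It denotes `h₁ ∨ ... ∨ hₙ ← b₁ ∧ ... ∧ bₘ` (empty head = ⊥, empty body = ⊤). -/
structure FClause (α : Type) where
  head : List (α × Bool)
  body : List (α × Bool)
  deriving DecidableEq

/-- The propositional formula of a literal. -/
def litToProp {α : Type} : α × Bool → PropForm α
  | (a, true) => .var a
  | (a, false) => PropForm.neg (.var a)

/-- The nested formula of a literal. -/
def litToNF {α : Type} : α × Bool → NF α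
  | (a, true) => .var a
  | (a, false) => .neg (.var a)

/-- Disjunction of a list of nested formulas (empty = ⊥). -/
def bigDisjNF {α : Type} : List (NF α) → NF α
  | [] => .bot
  | [A] => A
  | A :: L => .disj A (bigDisjNF L)

/-- Conjunction of a list of nested formulas (empty = ⊤). -/
def bigConjNF {α : Type} : List (NF α) → NF α
  | [] => .top
  | [A] => A
  | A :: L => .conj A (bigConjNF L)

namespace FClause

variable {α : Type}

/-- The propositional formula of a free clause. -/
def toProp (c : FClause α) : PropForm α :=
  .impl (bigConj (c.body.map litToProp)) (bigDisj (c.head.map litToProp))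

/-- A free clause as an augmented clause. -/
def toAug (c : FClause α) : AugClause α :=
  (bigDisjNF (c.head.map litToNF), bigConjNF (c.body.map litToNF))

/-- The atoms of a free clause. -/
def atomsF (c : FClause α) : Set α :=
  {a | (∃ b, (a, b) ∈ c.head) ∨ (∃ b, (a, b) ∈ c.body)}

/-- A general clause: all head literals are positive atoms. -/
def isGeneral (c : FClause α) : Prop := ∀ l ∈ c.head, l.2 = true

/-- A disjunctive clause: a general clause with nonempty head. -/
def isDisjunctive (c : FClause α) : Prop := c.isGeneral ∧ c.head ≠ []

/-- A constraint: a clause with empty head (head ⊥). -/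
def isConstraint (c : FClause α) : Prop := c.head = []

end FClause

/-- The theory of a free program. -/
def fTh {α : Type} (P : List (FClause α)) : Set (PropForm α) :=
  {F | ∃ c ∈ P, c.toProp = F}

/-- The signature of a free program. -/
def fSig {α : Type} (P : List (FClause α)) : Set α :=
  {a | ∃ c ∈ P, a ∈ c.atomsF}

/-- `GenDisj(P)`: each constraint `⊥ ← B` is replaced by `p ← B ∧ ¬p`,
where `p` is a new reserved atom. -/
def genDisj {α : Type} [DecidableEq α] (P : List (FClause α)) (p : α) :
    List (FClause α) :=
  P.map fun c =>
    if c.head = [] then ⟨[(p, true)], c.body ++ [(p, false)]⟩ else c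

/-- The atoms `a` such that `¬a` occurs in the head of some clause of `P`
(the set `S` of the FreeGen transformation), as a list. -/
def headNegs {α : Type} (P : List (FClause α)) : List α :=
  P.flatMap fun c => c.head.filterMap fun l => if l.2 = false then some l.1 else none

open scoped Classical in
/-- Replace the occurrence of `¬a` (for `a ∈ S`) by the positive atom `φ a`. -/
noncomputable def substLit {α : Type} (S : Set α) (φ : α → α) (l : α × Bool) :
    α × Bool :=
  if l.2 = false ∧ l.1 ∈ S then (φ l.1, true) else l

/-- Replace every occurrence of `¬a` (for `a ∈ S`) by `φ a` in a clause. -/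
noncomputable def FClause.subst {α : Type} (S : Set α) (φ : α → α) (c : FClause α) :
    FClause α :=
  ⟨c.head.map (substLit S φ), c.body.map (substLit S φ)⟩

/-- `Δ_S = ⋃_{a ∈ S} {φ(a) ← ¬a, ⊥ ← a ∧ φ(a)}`. -/
def deltaClauses {α : Type} (L : List α) (φ : α → α) : List (FClause α) :=
  L.flatMap fun a => [⟨[(φ a, true)], [(a, false)]⟩, ⟨[], [(a, true), (φ a, true)]⟩]

/-- `FreeGen(P) = P' ∪ Δ_S`. -/
noncomputable def freeGen {α : Type} (P : List (FClause α)) (φ : α → α) :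
    List (FClause α) :=
  P.map (FClause.subst {a | a ∈ headNegs P} φ) ++ deltaClauses (headNegs P) φ

open scoped Classical in
/-- The second reduction `redu2(P; ¬¬M)`: clauses whose body contains a literal
`¬a` with `a ∈ M` are deleted; in constraints, positive body literals `a ∈ M`
are deleted. -/
noncomputable def redu2 {α : Type} [DecidableEq α] (P : List (FClause α))
    (M : Set α) : List (FClause α) :=
  (P.filter fun c => decide (¬ ∃ l ∈ c.body, l.2 = false ∧ l.1 ∈ M)).map
    fun c =>
      if c.head = [] then
        ⟨[], c.body.filter fun l => decide (¬ (l.2 = true ∧ l.1 ∈ M))⟩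
      else c

/-- `P₂` is a conservative extension of `P₁`: `M₁` is an answer set of `P₁`
iff `M₂` is an answer set of `P₂`, where `M₁ = M₂ ∩ σ_{P₁}`. -/
def consExt {α : Type} (P1 P2 : List (AugClause α)) : Prop :=
  (∀ M2 : Set α, isAnswerSet P2 M2 → isAnswerSet P1 (M2 ∩ progSig P1)) ∧
  (∀ M1 : Set α, isAnswerSet P1 M1 →
    ∃ M2 : Set α, isAnswerSet P2 M2 ∧ M1 = M2 ∩ progSig P1)

/-- `P₂` is a strong conservative extension of the user program `P₁` (relative
to the user signature `U`): for every user program `P`, `P₂ ∪ P` is a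
conservative extension of `P₁ ∪ P`. -/
def strongConsExt {α : Type} (P1 P2 : List (AugClause α)) (U : Set α) : Prop :=
  ∀ P : List (AugClause α), progSig P ⊆ U → consExt (P1 ++ P) (P2 ++ P)

mutual
  /-- Negation normal form: push negations inward (no pending negation). -/
  def nnf0 {α : Type} : NF α → NF α
    | .var a => .var a
    | .top => .top
    | .bot => .bot
    | .conj A B => .conj (nnf0 A) (nnf0 B)
    | .disj A B => .disj (nnf0 A) (nnf0 B)
    | .neg A => nnf1 A
  /-- Negation normal form under one pending negation. -/
  def nnf1 {α : Type} : NF α → NF α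
    | .var a => .neg (.var a)
    | .top => .bot
    | .bot => .top
    | .conj A B => .disj (nnf1 A) (nnf1 B)
    | .disj A B => .conj (nnf1 A) (nnf1 B)
    | .neg A => nnf2 A
  /-- Negation normal form under two pending negations. -/
  def nnf2 {α : Type} : NF α → NF α
    | .var a => .neg (.neg (.var a))
    | .top => .top
    | .bot => .bot
    | .conj A B => .conj (nnf2 A) (nnf2 B)
    | .disj A B => .disj (nnf2 A) (nnf2 B)
    | .neg A => nnf1 A
end

/-- Conjunctive normal form (list of disjunction-lists of leaves). -/
def cnfNF {α : Type} : NF α → List (List (NF α))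
  | .conj A B => cnfNF A ++ cnfNF B
  | .disj A B => (cnfNF A).flatMap fun c => (cnfNF B).map fun d => c ++ d
  | F => [[F]]

/-- Disjunctive normal form (list of conjunction-lists of leaves). -/
def dnfNF {α : Type} : NF α → List (List (NF α))
  | .disj A B => dnfNF A ++ dnfNF B
  | .conj A B => (dnfNF A).flatMap fun c => (dnfNF B).map fun d => c ++ d
  | F => [[F]]

/-- Read a leaf as a literal (if it is one). -/
def leafLit {α : Type} : NF α → Option (α × Bool)
  | .var a => some (a, true)
  | .neg (.var a) => some (a, false)
  | _ => none

/-- Read a leaf `¬¬a` as the literal `¬a` to be moved to the other side. -/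
def dnegLit {α : Type} : NF α → Option (α × Bool)
  | .neg (.neg (.var a)) => some (a, false)
  | _ => none

/-- Build a free clause from a head disjunct-list and a body conjunct-list:
doubly negated atoms `¬¬a` in the head become `¬a` in the body and vice versa;
trivial clauses (⊤ in the head or ⊥ in the body) are removed. -/
def procClause {α : Type} [DecidableEq α] (hd bd : List (NF α)) :
    Option (FClause α) :=
  if NF.top ∈ hd ∨ NF.bot ∈ bd then none
  else some ⟨hd.filterMap leafLit ++ bd.filterMap dnegLit,
             bd.filterMap leafLit ++ hd.filterMap dnegLit⟩

/-- `AugFree(P)`: the free program obtained from the augmented program `P` by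
pushing negations inward, taking CNF of heads and DNF of bodies, splitting
conjunctions in heads and disjunctions in bodies into separate clauses, and
eliminating doubly negated atoms. -/
def augFree {α : Type} [DecidableEq α] (P : List (AugClause α)) :
    List (FClause α) :=
  P.flatMap fun c =>
    (cnfNF (nnf0 c.1)).flatMap fun hd =>
      (dnfNF (nnf0 c.2)).filterMap fun bd => procClause hd bd

/-- Positive formulas: no negation (in particular no ⊥) occurs. -/
def IsPositive {α : Type} : PropForm α → Prop
  | .var _ => True
  | .fals => False
  | .conj A B => IsPositive A ∧ IsPositive B
  | .disj A B => IsPositive A ∧ IsPositive B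
  | .impl A B => IsPositive A ∧ IsPositive B

/-- The set 𝐍 of two-negated formulas. -/
inductive IsTwoNeg {α : Type} : PropForm α → Prop
  | atom (a : α) : IsTwoNeg (neg (neg (var a)))
  | dneg {A} : IsTwoNeg A → IsTwoNeg (neg (neg A))
  | conj {A B} : IsTwoNeg A → IsTwoNeg B → IsTwoNeg (PropForm.conj A B)
  | disjL {A} (B) : IsTwoNeg A → IsTwoNeg (PropForm.disj A B)
  | disjR {A} (B) : IsTwoNeg A → IsTwoNeg (PropForm.disj B A)
  | himp {A} (B) : IsTwoNeg A → IsTwoNeg (PropForm.impl B A)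

section HeytingSemantics

variable {α : Type} {H : Type} [HeytingAlgebra H]

/-- Evaluation of a propositional formula in a Heyting algebra. -/
def heval (v : α → H) : PropForm α → H
  | .var a => v a
  | .fals => ⊥
  | .conj A B => heval v A ⊓ heval v B
  | .disj A B => heval v A ⊔ heval v B
  | .impl A B => heval v A ⇨ heval v B

@[simp] theorem heval_neg (v : α → H) (A : PropForm α) : heval v A.neg = (heval v A)ᶜ := by
  simp [PropForm.neg, heval]

@[simp] theorem heval_top (v : α → H) : heval v (PropForm.top : PropForm α) = ⊤ := by
  simp [PropForm.top, heval]

theorem heval_bigConj_cons (v : α → H) (A : PropForm α) (L : List (PropForm α)) :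
    heval v (bigConj (A :: L)) = heval v A ⊓ heval v (bigConj L) := by
  cases L <;> simp [bigConj, heval]

theorem heval_bigDisj_cons (v : α → H) (A : PropForm α) (L : List (PropForm α)) :
    heval v (bigDisj (A :: L)) = heval v A ⊔ heval v (bigDisj L) := by
  cases L <;> simp [bigDisj, heval]

theorem heval_bigConj_append (v : α → H) (L L' : List (PropForm α)) :
    heval v (bigConj (L ++ L')) = heval v (bigConj L) ⊓ heval v (bigConj L') := by
  induction L with
  | nil => simp [bigConj]
  | cons A L ih => simp only [List.cons_append, heval_bigConj_cons, ih, inf_assoc]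

theorem heval_bigDisj_append (v : α → H) (L L' : List (PropForm α)) :
    heval v (bigDisj (L ++ L')) = heval v (bigDisj L) ⊔ heval v (bigDisj L') := by
  induction L with
  | nil => simp [bigDisj, heval]
  | cons A L ih => simp only [List.cons_append, heval_bigDisj_cons, ih, sup_assoc]

theorem heval_bigConj_eq_top (v : α → H) (L : List (PropForm α))
    (h : ∀ G ∈ L, heval v G = ⊤) : heval v (bigConj L) = ⊤ := by
  induction L with
  | nil => simp [bigConj]
  | cons A L ih => simp_all [heval_bigConj_cons]

theorem Deriv.heval_eq_top {Ax : Set (PropForm α)} {F : PropForm α} (h : Deriv Ax F)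
    (v : α → H) (hv : ∀ G ∈ Ax, heval v G = ⊤) : heval v F = ⊤ := by
  induction h with
  | ax h => exact hv _ h
  | mp _ _ ih₁ ih₂ => simpa [heval, ih₂] using ih₁
  | s A B C =>
    simp only [heval, himp_eq_top_iff, le_himp_iff]
    generalize heval v A = a
    generalize heval v B = b
    generalize heval v C = c
    have h₁ : (a ⇨ b ⇨ c) ⊓ (a ⇨ b) ⊓ a ≤ b :=
      (inf_le_inf_right a inf_le_right).trans himp_inf_le
    have h₂ : (a ⇨ b ⇨ c) ⊓ (a ⇨ b) ⊓ a ≤ b ⇨ c :=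
      (inf_le_inf_right a inf_le_left).trans himp_inf_le
    exact (le_inf h₂ h₁).trans himp_inf_le
  | disjElim A B C =>
    simp only [heval, himp_eq_top_iff, le_himp_iff]
    rw [inf_sup_left]
    exact sup_le ((inf_le_inf_right _ inf_le_left).trans himp_inf_le)
      ((inf_le_inf_right _ inf_le_right).trans himp_inf_le)
  | _ => simp [heval]

end HeytingSemantics

section Lindenbaum

variable {α : Type} {Ax : Set (PropForm α)} {A B C : PropForm α}

theorem Deriv.weaken (h : Deriv Ax B) (A : PropForm α) : Deriv Ax (impl A B) :=
  .mp (.k _ _) h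

theorem Deriv.mp_under (h : Deriv Ax (impl A (impl B C))) (h' : Deriv Ax (impl A B)) :
    Deriv Ax (impl A C) :=
  .mp (.mp (.s _ _ _) h) h'

theorem Deriv.refl (A : PropForm α) : Deriv Ax (impl A A) :=
  .mp_under (.k A (impl A A)) (.k A A)

theorem Deriv.trans (h : Deriv Ax (impl A B)) (h' : Deriv Ax (impl B C)) :
    Deriv Ax (impl A C) :=
  .mp_under (h'.weaken A) h

theorem Deriv.conj_right (h : Deriv Ax (impl C A)) (h' : Deriv Ax (impl C B)) :
    Deriv Ax (impl C (conj A B)) :=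
  .mp_under (h.trans (.conjIntro _ _)) h'

theorem Deriv.disj_left (h : Deriv Ax (impl A C)) (h' : Deriv Ax (impl B C)) :
    Deriv Ax (impl (disj A B) C) :=
  .mp (.mp (.disjElim _ _ _) h) h'

theorem Deriv.impl_impl_iff :
    Deriv Ax (impl A (impl B C)) ↔ Deriv Ax (impl (conj A B) C) :=
  ⟨fun h => .mp_under ((Deriv.conjElimL A B).trans h) (.conjElimR A B),
   fun h => (Deriv.conjIntro A B).trans (.mp (.s _ _ _) (h.weaken B))⟩

/-- Formulas modulo provable equivalence from `Ax`. -/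
def lindenbaumSetoid (Ax : Set (PropForm α)) : Setoid (PropForm α) where
  r A B := Deriv Ax (impl A B) ∧ Deriv Ax (impl B A)
  iseqv :=
    ⟨fun A => ⟨.refl A, .refl A⟩, fun h => ⟨h.2, h.1⟩,
     fun h h' => ⟨h.1.trans h'.1, h'.2.trans h.2⟩⟩

/-- The Lindenbaum algebra of the theory `Ax`. -/
def Lindenbaum (Ax : Set (PropForm α)) : Type := Quotient (lindenbaumSetoid Ax)

/-- The class of a formula in the Lindenbaum algebra. -/
def Lindenbaum.mk (Ax : Set (PropForm α)) (A : PropForm α) : Lindenbaum Ax :=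
  Quotient.mk (lindenbaumSetoid Ax) A

instance : HeytingAlgebra (Lindenbaum Ax) where
  le := Quotient.lift₂ (fun A B => Deriv Ax (impl A B)) fun _ _ _ _ h h' =>
    propext ⟨fun k => (h.2.trans k).trans h'.1, fun k => (h.1.trans k).trans h'.2⟩
  le_refl := by rintro ⟨A⟩; exact .refl A
  le_trans := by rintro ⟨A⟩ ⟨B⟩ ⟨C⟩ h h'; exact Deriv.trans h h'
  le_antisymm := by rintro ⟨A⟩ ⟨B⟩ h h'; exact Quotient.sound ⟨h, h'⟩
  sup := Quotient.map₂ disj fun _ _ h _ _ h' =>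
    ⟨(h.1.trans (.disjIntroL _ _)).disj_left (h'.1.trans (.disjIntroR _ _)),
     (h.2.trans (.disjIntroL _ _)).disj_left (h'.2.trans (.disjIntroR _ _))⟩
  le_sup_left := by rintro ⟨A⟩ ⟨B⟩; exact .disjIntroL A B
  le_sup_right := by rintro ⟨A⟩ ⟨B⟩; exact .disjIntroR A B
  sup_le := by rintro ⟨A⟩ ⟨B⟩ ⟨C⟩ h h'; exact Deriv.disj_left h h'
  inf := Quotient.map₂ conj fun _ _ h _ _ h' =>
    ⟨((Deriv.conjElimL _ _).trans h.1).conj_right ((Deriv.conjElimR _ _).trans h'.1),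
     ((Deriv.conjElimL _ _).trans h.2).conj_right ((Deriv.conjElimR _ _).trans h'.2)⟩
  inf_le_left := by rintro ⟨A⟩ ⟨B⟩; exact .conjElimL A B
  inf_le_right := by rintro ⟨A⟩ ⟨B⟩; exact .conjElimR A B
  le_inf := by rintro ⟨A⟩ ⟨B⟩ ⟨C⟩ h h'; exact Deriv.conj_right h h'
  top := Lindenbaum.mk Ax PropForm.top
  le_top := by rintro ⟨A⟩; exact Deriv.weaken (.refl _) A
  bot := Lindenbaum.mk Ax fals
  bot_le := by rintro ⟨A⟩; exact .falsElim A
  himp := Quotient.map₂ impl fun _ _ h _ _ h' =>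
    ⟨Deriv.impl_impl_iff.2 (.trans (.mp_under (.conjElimL _ _) (.trans (.conjElimR _ _) h.2)) h'.1),
     Deriv.impl_impl_iff.2 (.trans (.mp_under (.conjElimL _ _) (.trans (.conjElimR _ _) h.1)) h'.2)⟩
  le_himp_iff := by rintro ⟨A⟩ ⟨B⟩ ⟨C⟩; exact Deriv.impl_impl_iff
  compl := Quotient.map PropForm.neg fun _ _ h =>
    ⟨Deriv.impl_impl_iff.2 (.mp_under (.conjElimL _ _) (.trans (.conjElimR _ _) h.2)),
     Deriv.impl_impl_iff.2 (.mp_under (.conjElimL _ _) (.trans (.conjElimR _ _) h.1))⟩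
  himp_bot := by rintro ⟨A⟩; rfl

theorem heval_lindenbaum (Ax : Set (PropForm α)) (F : PropForm α) :
    heval (fun a => Lindenbaum.mk Ax (var a)) F = Lindenbaum.mk Ax F := by
  induction F with
  | var a => rfl
  | fals => rfl
  | conj A B ihA ihB => rw [heval, ihA, ihB]; rfl
  | disj A B ihA ihB => rw [heval, ihA, ihB]; rfl
  | impl A B ihA ihB => rw [heval, ihA, ihB]; rfl

theorem Lindenbaum.mk_eq_top_iff {F : PropForm α} : Lindenbaum.mk Ax F = ⊤ ↔ Deriv Ax F := by
  rw [← top_le_iff]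
  exact ⟨fun h => .mp h (.refl _), fun h => Deriv.weaken h _⟩

/-- Completeness of intuitionistic derivability for Heyting-valued semantics. -/
theorem Deriv.of_heval {F : PropForm α}
    (h : ∀ (H : Type) [HeytingAlgebra H] (v : α → H),
      (∀ G ∈ Ax, heval v G = ⊤) → heval v F = ⊤) : Deriv Ax F := by
  rw [← Lindenbaum.mk_eq_top_iff, ← heval_lindenbaum]
  refine h _ _ fun G hG => ?_
  rw [heval_lindenbaum, Lindenbaum.mk_eq_top_iff]
  exact .ax hG

theorem IThm.of_heval {F : PropForm α}
    (h : ∀ (H : Type) [HeytingAlgebra H] (v : α → H), heval v F = ⊤) : IThm F :=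
  Deriv.of_heval fun H _ v _ => h H v

theorem IThm.heval_eq_top {F : PropForm α} (h : IThm F) {H : Type} [HeytingAlgebra H]
    (v : α → H) : heval v F = ⊤ :=
  Deriv.heval_eq_top h v (by simp)

theorem Deriv.iProves {T : Set (PropForm α)} {F : PropForm α} (h : Deriv T F) :
    IProves T F := by
  induction h with
  | ax h => exact ⟨[_], by simpa using h, .refl _⟩
  | mp _ _ ih₁ ih₂ =>
    obtain ⟨L₁, hL₁, h₁⟩ := ih₁
    obtain ⟨L₂, hL₂, h₂⟩ := ih₂
    refine ⟨L₁ ++ L₂, fun G hG => (List.mem_append.1 hG).elim (hL₁ G) (hL₂ G),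
      IThm.of_heval fun H _ v => ?_⟩
    have e₁ := h₁.heval_eq_top v
    have e₂ := h₂.heval_eq_top v
    simp only [heval, himp_eq_top_iff, le_himp_iff, heval_bigConj_append] at e₁ e₂ ⊢
    exact (inf_le_inf_left _ e₂).trans e₁
  | k A B => exact ⟨[], by simp, Deriv.weaken (.k A B) _⟩
  | s A B C => exact ⟨[], by simp, Deriv.weaken (.s A B C) _⟩
  | conjIntro A B => exact ⟨[], by simp, Deriv.weaken (.conjIntro A B) _⟩
  | conjElimL A B => exact ⟨[], by simp, Deriv.weaken (.conjElimL A B) _⟩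
  | conjElimR A B => exact ⟨[], by simp, Deriv.weaken (.conjElimR A B) _⟩
  | disjIntroL A B => exact ⟨[], by simp, Deriv.weaken (.disjIntroL A B) _⟩
  | disjIntroR A B => exact ⟨[], by simp, Deriv.weaken (.disjIntroR A B) _⟩
  | disjElim A B C => exact ⟨[], by simp, Deriv.weaken (.disjElim A B C) _⟩
  | falsElim A => exact ⟨[], by simp, Deriv.weaken (.falsElim A) _⟩

theorem iProves_iff_heval {T : Set (PropForm α)} {F : PropForm α} :
    IProves T F ↔ ∀ (H : Type) [HeytingAlgebra H] (v : α → H),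
      (∀ G ∈ T, heval v G = ⊤) → heval v F = ⊤ := by
  refine ⟨?_, fun h => (Deriv.of_heval h).iProves⟩
  rintro ⟨L, hL, h⟩ H _ v hv
  have e := h.heval_eq_top v
  rwa [heval, heval_bigConj_eq_top v L fun G hG => hv G (hL G hG), top_himp] at e

end Lindenbaum

section Decided

variable {α : Type} {H : Type} [HeytingAlgebra H]

/-- An element that is either `⊥` or dense: its negation takes a classical truth value. -/
def Decided (x : H) : Prop := x = ⊥ ∨ xᶜ = ⊥

variable {x y : H}

theorem Decided.compl_inf (hx : Decided x) (hy : Decided y) : (x ⊓ y)ᶜ = xᶜ ⊔ yᶜ := by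
  rcases hx with rfl | hx
  · simp
  rcases hy with rfl | hy
  · simp
  rw [← compl_compl_compl, compl_compl_inf_distrib]
  simp [hx, hy]

theorem Decided.compl_compl_sup (hx : Decided x) (hy : Decided y) :
    (x ⊔ y)ᶜᶜ = xᶜᶜ ⊔ yᶜᶜ := by
  rcases hx with rfl | hx
  · simp
  rcases hy with rfl | hy
  · simp
  simp [hx, hy]

theorem Decided.inf (hx : Decided x) (hy : Decided y) : Decided (x ⊓ y) := by
  have h := hx.compl_inf hy
  rcases hx with rfl | hx
  · simp [Decided]
  rcases hy with rfl | hy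
  · simp [Decided]
  exact .inr (by simp [h, hx, hy])

theorem Decided.sup (hx : Decided x) (hy : Decided y) : Decided (x ⊔ y) := by
  rcases hx with rfl | hx
  · simpa using hy
  · exact .inr (by simp [hx])

theorem Decided.compl (hx : Decided x) : Decided xᶜ := by
  rcases hx with rfl | hx
  · exact .inr (by simp)
  · exact .inl hx

theorem Decided.isCompl (hx : Decided x) : IsCompl xᶜ xᶜᶜ := by
  rcases hx with rfl | hx
  · simpa using isCompl_top_bot
  · simpa [hx] using isCompl_bot_top

variable {v : α → H} {S : Set α}

theorem Decided.heval_toProp (hS : ∀ a ∈ S, Decided (v a)) (F : NF α) (hF : F.atoms ⊆ S) :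
    Decided (heval v F.toProp) := by
  induction F with
  | var a => exact hS a (hF rfl)
  | top => exact .inr (by simp [NF.toProp])
  | bot => exact .inl rfl
  | conj A B ihA ihB =>
    rw [NF.atoms, Set.union_subset_iff] at hF
    exact (ihA hF.1).inf (ihB hF.2)
  | disj A B ihA ihB =>
    rw [NF.atoms, Set.union_subset_iff] at hF
    exact (ihA hF.1).sup (ihB hF.2)
  | neg A ih =>
    rw [NF.toProp, heval_neg]
    exact (ih hF).compl

theorem heval_nnf (hS : ∀ a ∈ S, Decided (v a)) (F : NF α) (hF : F.atoms ⊆ S) :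
    heval v (nnf0 F).toProp = heval v F.toProp ∧
    heval v (nnf1 F).toProp = (heval v F.toProp)ᶜ ∧
    heval v (nnf2 F).toProp = (heval v F.toProp)ᶜᶜ := by
  induction F with
  | var a => simp [nnf0, nnf1, nnf2, NF.toProp]
  | top => simp [nnf0, nnf1, nnf2, NF.toProp, heval]
  | bot => simp [nnf0, nnf1, nnf2, NF.toProp, heval]
  | conj A B ihA ihB =>
    rw [NF.atoms, Set.union_subset_iff] at hF
    have dA := Decided.heval_toProp hS A hF.1
    have dB := Decided.heval_toProp hS B hF.2
    simp [nnf0, nnf1, nnf2, NF.toProp, heval, ihA hF.1, ihB hF.2, dA.compl_inf dB]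
  | disj A B ihA ihB =>
    rw [NF.atoms, Set.union_subset_iff] at hF
    have dA := Decided.heval_toProp hS A hF.1
    have dB := Decided.heval_toProp hS B hF.2
    have h := dA.compl_compl_sup dB
    rw [compl_sup] at h
    simp [nnf0, nnf1, nnf2, NF.toProp, heval, ihA hF.1, ihB hF.2, h]
  | neg A ih =>
    simp [nnf0, nnf1, nnf2, NF.toProp, ih hF]

end Decided

section NormalForms

variable {α : Type}

/-- The leaves of negation normal forms over the atoms `S`. -/
inductive IsLeaf (S : Set α) : NF α → Prop
  | var {a} : a ∈ S → IsLeaf S (.var a)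
  | neg {a} : a ∈ S → IsLeaf S (.neg (.var a))
  | negneg {a} : a ∈ S → IsLeaf S (.neg (.neg (.var a)))
  | top : IsLeaf S .top
  | bot : IsLeaf S .bot

/-- Nested formulas over the atoms `S` in negation normal form. -/
inductive IsNNF (S : Set α) : NF α → Prop
  | leaf {F} : IsLeaf S F → IsNNF S F
  | conj {A B} : IsNNF S A → IsNNF S B → IsNNF S (.conj A B)
  | disj {A B} : IsNNF S A → IsNNF S B → IsNNF S (.disj A B)

variable {S : Set α}

theorem isNNF_nnf (F : NF α) (hF : F.atoms ⊆ S) :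
    IsNNF S (nnf0 F) ∧ IsNNF S (nnf1 F) ∧ IsNNF S (nnf2 F) := by
  induction F with
  | var a =>
    have ha : a ∈ S := hF rfl
    exact ⟨.leaf (.var ha), .leaf (.neg ha), .leaf (.negneg ha)⟩
  | top => exact ⟨.leaf .top, .leaf .bot, .leaf .top⟩
  | bot => exact ⟨.leaf .bot, .leaf .top, .leaf .bot⟩
  | conj A B ihA ihB =>
    rw [NF.atoms, Set.union_subset_iff] at hF
    obtain ⟨a₀, a₁, a₂⟩ := ihA hF.1
    obtain ⟨b₀, b₁, b₂⟩ := ihB hF.2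
    exact ⟨.conj a₀ b₀, .disj a₁ b₁, .conj a₂ b₂⟩
  | disj A B ihA ihB =>
    rw [NF.atoms, Set.union_subset_iff] at hF
    obtain ⟨a₀, a₁, a₂⟩ := ihA hF.1
    obtain ⟨b₀, b₁, b₂⟩ := ihB hF.2
    exact ⟨.disj a₀ b₀, .conj a₁ b₁, .disj a₂ b₂⟩
  | neg A ih =>
    obtain ⟨a₀, a₁, a₂⟩ := ih hF
    exact ⟨a₁, a₂, a₁⟩

theorem IsLeaf.cnfNF_eq {F : NF α} (h : IsLeaf S F) : cnfNF F = [[F]] := by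
  cases h <;> rfl

theorem IsLeaf.dnfNF_eq {F : NF α} (h : IsLeaf S F) : dnfNF F = [[F]] := by
  cases h <;> rfl

theorem IsNNF.isLeaf_of_mem_cnfNF {F : NF α} (h : IsNNF S F) :
    ∀ c ∈ cnfNF F, ∀ l ∈ c, IsLeaf S l := by
  induction h with
  | leaf h => simpa [h.cnfNF_eq] using h
  | conj _ _ ihA ihB =>
    intro c hc
    exact (List.mem_append.1 hc).elim (ihA c) (ihB c)
  | disj _ _ ihA ihB =>
    intro c hc l hl
    simp only [cnfNF, List.mem_flatMap, List.mem_map] at hc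
    obtain ⟨c₁, h₁, c₂, h₂, rfl⟩ := hc
    exact (List.mem_append.1 hl).elim (ihA c₁ h₁ l) (ihB c₂ h₂ l)

theorem IsNNF.isLeaf_of_mem_dnfNF {F : NF α} (h : IsNNF S F) :
    ∀ c ∈ dnfNF F, ∀ l ∈ c, IsLeaf S l := by
  induction h with
  | leaf h => simpa [h.dnfNF_eq] using h
  | disj _ _ ihA ihB =>
    intro c hc
    exact (List.mem_append.1 hc).elim (ihA c) (ihB c)
  | conj _ _ ihA ihB =>
    intro c hc l hl
    simp only [dnfNF, List.mem_flatMap, List.mem_map] at hc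
    obtain ⟨c₁, h₁, c₂, h₂, rfl⟩ := hc
    exact (List.mem_append.1 hl).elim (ihA c₁ h₁ l) (ihB c₂ h₂ l)

variable {H : Type} [HeytingAlgebra H]

/-- The conjunction of a list of disjunctions. -/
def cnfToProp (L : List (List (NF α))) : PropForm α :=
  bigConj (L.map fun c => bigDisj (c.map NF.toProp))

/-- The disjunction of a list of conjunctions. -/
def dnfToProp (L : List (List (NF α))) : PropForm α :=
  bigDisj (L.map fun c => bigConj (c.map NF.toProp))

theorem heval_cnfToProp_cons (v : α → H) (c : List (NF α)) (L : List (List (NF α))) :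
    heval v (cnfToProp (c :: L)) =
      heval v (bigDisj (c.map NF.toProp)) ⊓ heval v (cnfToProp L) :=
  heval_bigConj_cons ..

theorem heval_cnfToProp_append (v : α → H) (L L' : List (List (NF α))) :
    heval v (cnfToProp (L ++ L')) = heval v (cnfToProp L) ⊓ heval v (cnfToProp L') := by
  rw [cnfToProp, List.map_append, heval_bigConj_append]; rfl

theorem heval_dnfToProp_cons (v : α → H) (c : List (NF α)) (L : List (List (NF α))) :
    heval v (dnfToProp (c :: L)) =
      heval v (bigConj (c.map NF.toProp)) ⊔ heval v (dnfToProp L) :=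
  heval_bigDisj_cons ..

theorem heval_dnfToProp_append (v : α → H) (L L' : List (List (NF α))) :
    heval v (dnfToProp (L ++ L')) = heval v (dnfToProp L) ⊔ heval v (dnfToProp L') := by
  rw [dnfToProp, List.map_append, heval_bigDisj_append]; rfl

theorem heval_cnfToProp_map_append (v : α → H) (c : List (NF α)) (L : List (List (NF α))) :
    heval v (cnfToProp (L.map (c ++ ·))) =
      heval v (bigDisj (c.map NF.toProp)) ⊔ heval v (cnfToProp L) := by
  induction L with
  | nil => simp [cnfToProp, bigConj]
  | cons d L ih =>
    rw [List.map_cons, heval_cnfToProp_cons, ih, heval_cnfToProp_cons, sup_inf_left,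
      List.map_append, heval_bigDisj_append]

theorem heval_dnfToProp_map_append (v : α → H) (c : List (NF α)) (L : List (List (NF α))) :
    heval v (dnfToProp (L.map (c ++ ·))) =
      heval v (bigConj (c.map NF.toProp)) ⊓ heval v (dnfToProp L) := by
  induction L with
  | nil => simp [dnfToProp, bigDisj, heval]
  | cons d L ih =>
    rw [List.map_cons, heval_dnfToProp_cons, ih, heval_dnfToProp_cons, inf_sup_left,
      List.map_append, heval_bigConj_append]

theorem IsNNF.heval_cnfNF {F : NF α} (h : IsNNF S F) (v : α → H) :
    heval v (cnfToProp (cnfNF F)) = heval v F.toProp := by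
  induction h with
  | leaf h => rw [h.cnfNF_eq]; rfl
  | conj _ _ ihA ihB => rw [cnfNF, heval_cnfToProp_append, ihA, ihB]; rfl
  | @disj A B _ _ ihA ihB =>
    rw [NF.toProp, heval, ← ihA, ← ihB, cnfNF]
    induction cnfNF A with
    | nil => simp [cnfToProp, bigConj]
    | cons c L ih =>
      rw [List.flatMap_cons, heval_cnfToProp_append, ih, heval_cnfToProp_map_append,
        heval_cnfToProp_cons, sup_inf_right]

theorem IsNNF.heval_dnfNF {F : NF α} (h : IsNNF S F) (v : α → H) :
    heval v (dnfToProp (dnfNF F)) = heval v F.toProp := by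
  induction h with
  | leaf h => rw [h.dnfNF_eq]; rfl
  | disj _ _ ihA ihB => rw [dnfNF, heval_dnfToProp_append, ihA, ihB]; rfl
  | @conj A B _ _ ihA ihB =>
    rw [NF.toProp, heval, ← ihA, ← ihB, dnfNF]
    induction dnfNF A with
    | nil => simp [dnfToProp, bigDisj, heval]
    | cons c L ih =>
      rw [List.flatMap_cons, heval_dnfToProp_append, ih, heval_dnfToProp_map_append,
        heval_dnfToProp_cons, inf_sup_right]

theorem le_heval_bigConj_map_iff {β : Type} (v : α → H) (f : β → PropForm α) (L : List β)
    (x : H) : x ≤ heval v (bigConj (L.map f)) ↔ ∀ b ∈ L, x ≤ heval v (f b) := by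
  induction L with
  | nil => simp [bigConj]
  | cons b L ih => simp [heval_bigConj_cons, ih]

theorem heval_bigDisj_map_le_iff {β : Type} (v : α → H) (f : β → PropForm α) (L : List β)
    (x : H) : heval v (bigDisj (L.map f)) ≤ x ↔ ∀ b ∈ L, heval v (f b) ≤ x := by
  induction L with
  | nil => simp [bigDisj, heval]
  | cons b L ih => simp [heval_bigDisj_cons, ih]

theorem heval_head_split {v : α → H} (hS : ∀ a ∈ S, Decided (v a)) (hd : List (NF α))
    (hl : ∀ l ∈ hd, IsLeaf S l) (ht : NF.top ∉ hd) :
    ∃ p, heval v (bigDisj (hd.map NF.toProp)) =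
        heval v (bigDisj ((hd.filterMap leafLit).map litToProp)) ⊔ p ∧
      IsCompl (heval v (bigConj ((hd.filterMap dnegLit).map litToProp))) p := by
  induction hd with
  | nil => exact ⟨⊥, by simp, by simpa [bigConj] using isCompl_top_bot⟩
  | cons l hd ih =>
    simp only [List.mem_cons, not_or, forall_eq_or_imp] at hl ht
    obtain ⟨p, h₁, h₂⟩ := ih hl.2 ht.2
    rw [List.map_cons, heval_bigDisj_cons, h₁]
    cases hl.1 with
    | var ha =>
      refine ⟨p, ?_, h₂⟩
      simp [leafLit, litToProp, NF.toProp, heval_bigDisj_cons, sup_assoc]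
    | neg ha =>
      refine ⟨p, ?_, h₂⟩
      simp [leafLit, litToProp, NF.toProp, heval_bigDisj_cons, sup_assoc]
    | @negneg a ha =>
      refine ⟨(v a)ᶜᶜ ⊔ p, ?_, ?_⟩
      · simp [List.filterMap_cons_none (show leafLit (.neg (.neg (.var a))) = none from rfl),
          NF.toProp, heval, sup_left_comm]
      · simpa [dnegLit, litToProp, heval_bigConj_cons, heval] using
          (hS a ha).isCompl.inf_sup h₂
    | top => exact absurd rfl ht.1
    | bot => exact ⟨p, by simp [List.filterMap_cons_none (show leafLit .bot = none from rfl),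
      NF.toProp, heval], h₂⟩

theorem heval_body_split {v : α → H} (hS : ∀ a ∈ S, Decided (v a)) (bd : List (NF α))
    (hl : ∀ l ∈ bd, IsLeaf S l) (ht : NF.bot ∉ bd) :
    ∃ p, heval v (bigConj (bd.map NF.toProp)) =
        heval v (bigConj ((bd.filterMap leafLit).map litToProp)) ⊓ p ∧
      IsCompl p (heval v (bigDisj ((bd.filterMap dnegLit).map litToProp))) := by
  induction bd with
  | nil => exact ⟨⊤, by simp, by simpa [bigDisj, heval] using isCompl_top_bot⟩
  | cons l bd ih =>
    simp only [List.mem_cons, not_or, forall_eq_or_imp] at hl ht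
    obtain ⟨p, h₁, h₂⟩ := ih hl.2 ht.2
    rw [List.map_cons, heval_bigConj_cons, h₁]
    cases hl.1 with
    | var ha =>
      refine ⟨p, ?_, h₂⟩
      simp [leafLit, litToProp, NF.toProp, heval_bigConj_cons, inf_assoc]
    | neg ha =>
      refine ⟨p, ?_, h₂⟩
      simp [leafLit, litToProp, NF.toProp, heval_bigConj_cons, inf_assoc]
    | @negneg a ha =>
      refine ⟨(v a)ᶜᶜ ⊓ p, ?_, ?_⟩
      · simp [List.filterMap_cons_none (show leafLit (.neg (.neg (.var a))) = none from rfl),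
          NF.toProp, heval, inf_left_comm]
      · simpa [dnegLit, litToProp, heval_bigDisj_cons, heval] using
          (hS a ha).isCompl.symm.inf_sup h₂
    | bot => exact absurd rfl ht.1
    | top => exact ⟨p, by simp [List.filterMap_cons_none (show leafLit .top = none from rfl),
      NF.toProp], h₂⟩

theorem heval_procClause [DecidableEq α] {v : α → H} (hS : ∀ a ∈ S, Decided (v a))
    (hd bd : List (NF α)) (hh : ∀ l ∈ hd, IsLeaf S l) (hb : ∀ l ∈ bd, IsLeaf S l) :
    (∀ c, procClause hd bd = some c → heval v c.toProp = ⊤) ↔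
      heval v (bigConj (bd.map NF.toProp)) ≤ heval v (bigDisj (hd.map NF.toProp)) := by
  unfold procClause
  split_ifs with h
  · simp only [false_imp_iff, implies_true, true_iff]
    rcases h with h | h
    · refine le_top.trans ?_
      simpa [NF.toProp] using (heval_bigDisj_map_le_iff v NF.toProp hd _).1 le_rfl _ h
    · exact ((le_heval_bigConj_map_iff v NF.toProp bd _).1 le_rfl _ h).trans bot_le
  · rw [not_or] at h
    obtain ⟨p, hp, hp'⟩ := heval_head_split hS hd hh h.1
    obtain ⟨q, hq, hq'⟩ := heval_body_split hS bd hb h.2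
    simp only [Option.some.injEq, forall_eq', FClause.toProp, heval, himp_eq_top_iff,
      List.map_append, heval_bigConj_append, heval_bigDisj_append]
    rw [hp, hq, hq'.le_sup_right_iff_inf_left_le, inf_right_comm,
      ← hp'.le_sup_right_iff_inf_left_le]

theorem heval_clause_iff [DecidableEq α] {v : α → H} (hS : ∀ a ∈ S, Decided (v a))
    (c : AugClause α) (hc : c.1.atoms ∪ c.2.atoms ⊆ S) :
    heval v (clauseToProp c) = ⊤ ↔
      ∀ hd ∈ cnfNF (nnf0 c.1), ∀ bd ∈ dnfNF (nnf0 c.2), ∀ d, procClause hd bd = some d →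
        heval v d.toProp = ⊤ := by
  rw [Set.union_subset_iff] at hc
  have h₁ := (isNNF_nnf c.1 hc.1).1
  have h₂ := (isNNF_nnf c.2 hc.2).1
  rw [clauseToProp, heval, himp_eq_top_iff, ← (heval_nnf hS c.1 hc.1).1,
    ← (heval_nnf hS c.2 hc.2).1, ← h₁.heval_cnfNF, ← h₂.heval_dnfNF, cnfToProp, dnfToProp,
    le_heval_bigConj_map_iff]
  simp only [heval_bigDisj_map_le_iff]
  refine forall₄_congr fun hd hhd bd hbd => ?_
  exact (heval_procClause hS hd bd (h₁.isLeaf_of_mem_cnfNF hd hhd)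
    (h₂.isLeaf_of_mem_dnfNF bd hbd)).symm

theorem heval_augFree_iff [DecidableEq α] {v : α → H} (P : List (AugClause α))
    (hS : ∀ a ∈ progSig P, Decided (v a)) :
    (∀ F ∈ fTh (augFree P), heval v F = ⊤) ↔ ∀ F ∈ progTh P, heval v F = ⊤ := by
  have key : ∀ c ∈ P, _ := fun c hc =>
    heval_clause_iff hS c fun a ha => ⟨c, hc, ha⟩
  constructor
  · rintro h _ ⟨c, hc, rfl⟩
    refine (key c hc).2 fun hd hhd bd hbd d hd' => h _ ⟨d, ?_, rfl⟩
    simp only [augFree, List.mem_flatMap, List.mem_filterMap]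
    exact ⟨c, hc, hd, hhd, bd, hbd, hd'⟩
  · rintro h _ ⟨d, hd, rfl⟩
    simp only [augFree, List.mem_flatMap, List.mem_filterMap] at hd
    obtain ⟨c, hc, hd, hhd, bd, hbd, hd'⟩ := hd
    exact (key c hc).1 (h _ ⟨c, hc, rfl⟩) hd hhd bd hbd d hd'

end NormalForms

theorem decided_of_negSet_negnegSet {α H : Type} [HeytingAlgebra H] {v : α → H} {S M : Set α}
    (h : ∀ F ∈ negSet (S \ M) ∪ negnegSet M, heval v F = ⊤) : ∀ a ∈ S, Decided (v a) := by
  intro a ha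
  by_cases haM : a ∈ M
  · have e := h _ (.inr ⟨a, haM, rfl⟩)
    rw [heval_neg, heval_neg, ← himp_bot, himp_eq_top_iff, le_bot_iff] at e
    exact .inr e
  · have e := h _ (.inl ⟨a, ⟨ha, haM⟩, rfl⟩)
    rw [heval_neg, ← himp_bot, himp_eq_top_iff, le_bot_iff] at e
    exact .inl e

theorem augFree_iProves_iff {α : Type} [DecidableEq α] (P : List (AugClause α))
    (M : Set α) (F : PropForm α) :
    IProves (fTh (augFree P) ∪ negSet (progSig P \ M) ∪ negnegSet M) F ↔
      IProves (progTh P ∪ negSet (progSig P \ M) ∪ negnegSet M) F := by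
  have split (T U : Set (PropForm α)) (p : PropForm α → Prop) :
      (∀ G ∈ T ∪ U, p G) ↔ (∀ G ∈ T, p G) ∧ ∀ G ∈ U, p G := by
    simp only [Set.mem_union, or_imp, forall_and]
  simp only [iProves_iff_heval, Set.union_assoc, split (fTh _), split (progTh _)]
  refine forall₃_congr fun H _ v => imp_congr_left (and_congr_left fun h => ?_)
  exact heval_augFree_iff P (decided_of_negSet_negnegSet h)

/-- for an augmented program `P` and `M ⊆ σ_P`,
`AugFree(P) ∪ ¬M̃ ∪ ¬¬M ⊩_I M` iff `P ∪ ¬M̃ ∪ ¬¬M ⊩_I M`. -/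
theorem augFree_proves_iff {α : Type} [DecidableEq α] (P : List (AugClause α))
    (M : Set α) (hM : M ⊆ progSig P) :
    IProvesAll (fTh (augFree P) ∪ negSet (progSig P \ M) ∪ negnegSet M) M ↔
      IProvesAll (progTh P ∪ negSet (progSig P \ M) ∪ negnegSet M) M := by
  simp only [IProvesAll, IConsistent, augFree_iProves_iff]

end ASP
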